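/- arXiv:1807.05514 — 6 statements merged into one kernel-verified Lean document; each statement's English description precedes it below -/
import Mathlib

section
/- There exists a temporary exchange instance whose core is empty. Concretely, the instance with five agents N = {0,1,2,3,4}, where each agent i owns house h_i and agent i's preferences over outcomes are (h_{i+1 mod 5}, i+1 mod 5) ≻_i (h_{i-1 mod 5}, i-1 mod 5) ≻_i (h_i, i), with every other outcome strictly less preferred than (h_i, i), admits no core stable allocation. -/
open scoped Classical

/-- The outcome of agent `i` under allocation `σ`: the owner of the house `i` receives,
and the tenant who receives `i`'s own house. -/
def outcome {N : Type*} (σ : Equiv.Perm N) (i : N) : N × N := (σ i, σ.symm i)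

/-- Strict preference derived from a weak preference relation `r` (where `r a b` means
`a` is at least as preferred as `b`). -/
def SPref {α : Type*} (r : α → α → Prop) (a b : α) : Prop := r a b ∧ ¬ r b a

/-- A nonempty coalition `S` blocks allocation `σ`: there is a permutation `τ` of `S`
(fixing all agents outside `S`) under which every member of `S` is strictly better off. -/
def Blocks {N : Type*} (pref : N → (N × N) → (N × N) → Prop)
    (σ : Equiv.Perm N) (S : Set N) : Prop :=
  S.Nonempty ∧ ∃ τ : Equiv.Perm N, (∀ i ∉ S, τ i = i) ∧
    ∀ i ∈ S, SPref (pref i) (outcome τ i) (outcome σ i)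

/-- An allocation is core stable if no coalition blocks it. -/
def CoreStable {N : Type*} (pref : N → (N × N) → (N × N) → Prop) (σ : Equiv.Perm N) : Prop :=
  ∀ S : Set N, ¬ Blocks pref σ S

/-- Utility of agent `i` in the five-agent instance: the top outcome is a swap with
agent `i+1`, then a swap with agent `i-1`, then keeping her own house; every other
outcome is strictly worse. -/
def fiveU (i : Fin 5) (x : Fin 5 × Fin 5) : ℕ :=
  if x = (i + 1, i + 1) then 3
  else if x = (i - 1, i - 1) then 2
  else if x = (i, i) then 1
  else 0

/-- The preference relation of agent `i` in the five-agent instance. -/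
def fivePref (i : Fin 5) (a b : Fin 5 × Fin 5) : Prop := fiveU i b ≤ fiveU i a

/-- Agents `i` and `i + 1` swap houses under `σ`. -/
def SwapsNext (σ : Equiv.Perm (Fin 5)) (i : Fin 5) : Prop :=
  σ i = i + 1 ∧ σ (i + 1) = i

theorem outcome_eq_diag_iff {N : Type*} (σ : Equiv.Perm N) (i j : N) :
    outcome σ i = (j, j) ↔ σ i = j ∧ σ j = i := by
  simp only [outcome, Prod.mk.injEq, Equiv.symm_apply_eq, eq_comm (a := i)]

theorem fiveU_le_two {i : Fin 5} {x : Fin 5 × Fin 5} (h : x ≠ (i + 1, i + 1)) :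
    fiveU i x ≤ 2 := by
  rw [fiveU, if_neg h]
  split_ifs <;> omega

theorem fiveU_le_one {i : Fin 5} {x : Fin 5 × Fin 5} (h : x ≠ (i + 1, i + 1))
    (h' : x ≠ (i - 1, i - 1)) : fiveU i x ≤ 1 := by
  rw [fiveU, if_neg h, if_neg h']
  split_ifs <;> omega

theorem fiveU_swap_next (i : Fin 5) : fiveU i (i + 1, i + 1) = 3 := by
  simp [fiveU]

theorem fiveU_swap_prev (i : Fin 5) : fiveU (i + 1) (i, i) = 2 := by
  have h : i ≠ i + 1 + 1 := by revert i; decide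
  simp [fiveU, h]

theorem sPref_fivePref_of_lt {i : Fin 5} {a b : Fin 5 × Fin 5} (h : fiveU i b < fiveU i a) :
    SPref (fivePref i) a b :=
  ⟨h.le, not_le.mpr h⟩

/-- If neither `i` nor `i + 1` swaps with her successor, then `i` and `i + 1` block by swapping. -/
theorem CoreStable.swapsNext_or {σ : Equiv.Perm (Fin 5)} (hσ : CoreStable fivePref σ)
    (i : Fin 5) : SwapsNext σ i ∨ SwapsNext σ (i + 1) := by
  by_contra! h
  obtain ⟨h₁, h₂⟩ := h
  refine hσ {i, i + 1} ⟨⟨i, by simp⟩, Equiv.swap i (i + 1), ?_, ?_⟩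
  · intro j hj
    simp only [Set.mem_insert_iff, Set.mem_singleton_iff, not_or] at hj
    exact Equiv.swap_apply_of_ne_of_ne hj.1 hj.2
  · rintro j (rfl | rfl) <;> apply sPref_fivePref_of_lt
    · have hτ : outcome (Equiv.swap j (j + 1)) j = (j + 1, j + 1) := by simp [outcome]
      rw [hτ, fiveU_swap_next, Nat.lt_succ_iff]
      exact fiveU_le_two fun h => h₁ ((outcome_eq_diag_iff σ _ _).mp h)
    · have hτ : outcome (Equiv.swap i (i + 1)) (i + 1) = (i, i) := by simp [outcome]
      rw [hτ, fiveU_swap_prev, Nat.lt_succ_iff]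
      refine fiveU_le_one (fun h => h₂ ((outcome_eq_diag_iff σ _ _).mp h)) fun h => h₁ ?_
      rw [add_sub_cancel_right] at h
      exact ((outcome_eq_diag_iff σ _ _).mp h).symm

theorem SwapsNext.not_succ {σ : Equiv.Perm (Fin 5)} {i : Fin 5} (h : SwapsNext σ i) :
    ¬ SwapsNext σ (i + 1) := by
  intro h'
  have hne : ∀ j : Fin 5, j ≠ j + 1 + 1 := by decide
  exact hne i (h.2.symm.trans h'.1)

/-- the five-agent temporary exchange instance admits no core stable
allocation, i.e., its core is empty. -/
theorem five_agent_instance_has_empty_core :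
    ∀ σ : Equiv.Perm (Fin 5), ¬ CoreStable fivePref σ := by
  intro σ hσ
  have alt (i : Fin 5) : SwapsNext σ (i + 1) ↔ ¬ SwapsNext σ i :=
    ⟨fun h h' => h'.not_succ h, (hσ.swapsNext_or i).resolve_left⟩
  have h₀ : SwapsNext σ 1 ↔ ¬ SwapsNext σ 0 := alt 0
  have h₁ : SwapsNext σ 2 ↔ ¬ SwapsNext σ 1 := alt 1
  have h₂ : SwapsNext σ 3 ↔ ¬ SwapsNext σ 2 := alt 2
  have h₃ : SwapsNext σ 4 ↔ ¬ SwapsNext σ 3 := alt 3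
  have h₄ : SwapsNext σ 0 ↔ ¬ SwapsNext σ 4 := alt 4
  tauto
end

section
/- In the five-agent temporary exchange instance where each agent i ∈ {0,1,2,3,4} owns house h_i and has preferences (h_{i+1 mod 5}, i+1 mod 5) ≻_i (h_{i-1 mod 5}, i-1 mod 5) ≻_i (h_i, i), with all other outcomes strictly below (h_i, i), every individually rational allocation σ leaves at least one agent with her own house, i.e., there exists j with σ(j) = j. -/
open scoped Classical

/-- An allocation is individually rational if every agent weakly prefers her outcome
to keeping her own house. -/
def IndividuallyRational {N : Type*} (pref : N → (N × N) → (N × N) → Prop)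
    (σ : Equiv.Perm N) : Prop :=
  ∀ i, pref i (outcome σ i) (i, i)

/-- Keeping her own house has positive utility for every agent. -/
theorem fiveU_self_pos (i : Fin 5) : 0 < fiveU i (i, i) := by
  unfold fiveU
  split_ifs <;> simp_all

/-- Only outcomes in which an agent swaps houses with her tenant have positive utility. -/
theorem fst_eq_snd_of_fiveU_pos {i : Fin 5} {x : Fin 5 × Fin 5} (h : 0 < fiveU i x) :
    x.1 = x.2 := by
  unfold fiveU at h
  split_ifs at h <;> simp_all

/-- Individually rational allocations in the five-agent instance are involutions. -/
theorem IndividuallyRational.sq_eq_one {σ : Equiv.Perm (Fin 5)}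
    (hσ : IndividuallyRational fivePref σ) : σ ^ 2 = 1 := by
  ext1 i
  have h : σ i = σ.symm i := fst_eq_snd_of_fiveU_pos ((fiveU_self_pos i).trans_le (hσ i))
  rw [sq, Equiv.Perm.mul_apply, h, Equiv.apply_symm_apply, Equiv.Perm.one_apply]

/-- in the five-agent instance, every individually rational allocation
leaves at least one agent with her own house. -/
theorem five_agent_IR_allocation_has_fixed_point :
    ∀ σ : Equiv.Perm (Fin 5), IndividuallyRational fivePref σ →
      ∃ j : Fin 5, σ j = j := by
  intro σ hσ
  exact Equiv.Perm.exists_fixed_point_of_prime (p := 2) (n := 1) (by simp)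
    (by simpa using hσ.sq_eq_one)
end

section
/- Every temporary exchange instance in which all agents have house-predominant preferences admits an allocation that is both core stable and Pareto optimal. -/
open scoped Classical

/-- An allocation `σ` is Pareto optimal if no allocation makes every agent weakly
better off and some agent strictly better off. -/
def ParetoOptimal {N : Type*} (pref : N → (N × N) → (N × N) → Prop)
    (σ : Equiv.Perm N) : Prop :=
  ¬ ∃ τ : Equiv.Perm N, (∀ i, pref i (outcome τ i) (outcome σ i)) ∧
      ∃ j, SPref (pref j) (outcome τ j) (outcome σ j)

/-- The house-predominant (weak) preference over outcomes induced by a strict order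
`hs` over house-owners and a strict order `ns` over tenants: lexicographic with
houses first. -/
def housePredPref {N : Type*} (hs ns : N → N → Prop) (a b : N × N) : Prop :=
  hs a.1 b.1 ∨ (a.1 = b.1 ∧ (ns a.2 b.2 ∨ a.2 = b.2))

/-- A self-map of a nonempty finite type has a periodic point. -/
theorem Function.periodicPts_nonempty_of_finite {α : Type*} [Finite α] [Nonempty α] (f : α → α) :
    (Function.periodicPts f).Nonempty := by
  obtain ⟨x⟩ := ‹Nonempty α›
  obtain ⟨m, n, hne, heq⟩ := Finite.exists_ne_map_eq_of_infinite fun n : ℕ => f^[n] x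
  wlog h : m < n generalizing m n
  · exact this n m hne.symm heq.symm (by omega)
  refine ⟨f^[m] x, n - m, by omega, ?_⟩
  change f^[n - m] (f^[m] x) = f^[m] x
  rw [← Function.iterate_add_apply, Nat.sub_add_cancel h.le]
  exact heq.symm

/-- Top trading cycles among the agents of `R`: some allocation of the houses of `R` cannot be
weakly improved by any subset of `R` except by trading exactly as in that allocation. -/
theorem exists_perm_strict_core_on {N : Type*} [Finite N] (hs : N → N → N → Prop)
    (hhs : ∀ i, IsStrictOrder N (hs i)) (R : Finset N) :
    ∃ σ : Equiv.Perm N, (∀ i ∉ R, σ i = i) ∧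
      ∀ (τ : Equiv.Perm N) (S : Set N), S ⊆ R → Set.MapsTo τ S S →
        (∀ i ∈ S, hs i (τ i) (σ i) ∨ τ i = σ i) → ∀ i ∈ S, τ i = σ i := by
  induction R using Finset.strongInduction with
  | H R ih =>
    rcases R.eq_empty_or_nonempty with rfl | hR
    · exact ⟨1, fun _ _ => rfl, fun τ S hS _ _ i hi => absurd (hS hi) (by simp)⟩
    have best : ∀ i, ∃ b ∈ R, ∀ x ∈ R, ¬ hs i x b := fun i => by
      have := hhs i
      exact (Finite.wellFounded_of_trans_of_irrefl (hs i)).has_min (R : Set N) hR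
    choose f hfR hf using best
    have : Nonempty N := ⟨hR.choose⟩
    set C := Function.periodicPts f
    have hbij : Set.BijOn f C C := Function.bijOn_periodicPts f
    have hCR : ∀ i ∈ C, i ∈ R := fun i hi => by
      obtain ⟨j, -, rfl⟩ := hbij.surjOn hi
      exact hfR j
    obtain ⟨c, hc⟩ : C.Nonempty := Function.periodicPts_nonempty_of_finite f
    obtain ⟨ρ, hρ, hcore⟩ := ih (R.filter (· ∉ C))
      (Finset.filter_ssubset.2 ⟨c, hCR c hc, not_not.2 hc⟩)
    have hρC : ∀ i ∈ C, ρ i = i := fun i hi => hρ i (by simp [hi])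
    have hρC' : ∀ i ∉ C, ρ i ∉ C := fun i hi h => hi (ρ.injective (hρC _ h) ▸ h)
    have hinj : Function.Injective fun i => if i ∈ C then f i else ρ i := by
      intro i j hij
      by_cases hi : i ∈ C <;> by_cases hj : j ∈ C <;> simp only [hi, hj, if_true, if_false] at hij
      · exact hbij.injOn hi hj hij
      · exact absurd (hij ▸ hbij.mapsTo hi) (hρC' j hj)
      · exact absurd (hij ▸ hbij.mapsTo hj) (hρC' i hi)
      · exact ρ.injective hij
    obtain ⟨σ, hσ⟩ : ∃ σ : Equiv.Perm N, ∀ i, σ i = if i ∈ C then f i else ρ i :=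
      ⟨Equiv.ofBijective _ (Finite.injective_iff_bijective.1 hinj), fun _ => rfl⟩
    refine ⟨σ, fun i hi => ?_, fun τ S hSR hτ hweak => ?_⟩
    · rw [hσ, if_neg fun h => hi (hCR i h), hρ i fun h => hi (Finset.mem_filter.1 h).1]
    have hτC : ∀ i ∈ S, i ∈ C → τ i = f i := fun i hi hiC => by
      have := hweak i hi
      rw [hσ, if_pos hiC] at this
      exact this.resolve_left (hf i _ (hSR (hτ hi)))
    have hmaps : Set.MapsTo τ (S ∩ C) (S ∩ C) := fun i hi =>
      ⟨hτ hi.1, hτC i hi.1 hi.2 ▸ hbij.mapsTo hi.2⟩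
    have hmaps' : Set.MapsTo τ (S \ C) (S \ C) := fun i hi => by
      refine ⟨hτ hi.1, fun h => hi.2 ?_⟩
      have := Equiv.Perm.perm_symm_mapsTo_of_mapsTo τ hmaps
        (show τ i ∈ S ∩ C from ⟨hτ hi.1, h⟩)
      simpa using this.2
    have hrest := hcore τ (S \ C)
      (fun i hi => Finset.mem_coe.2 (Finset.mem_filter.2 ⟨hSR hi.1, hi.2⟩)) hmaps'
      (fun i hi => by simpa only [hσ, if_neg hi.2] using hweak i hi.1)
    intro i hi
    by_cases hiC : i ∈ C
    · rw [hσ, if_pos hiC, hτC i hi hiC]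
    · rw [hσ, if_neg hiC, hrest i ⟨hi, hiC⟩]

/-- Allocations that agree on a set invariant under one of them give its members the same
outcomes. -/
theorem outcome_eq_of_eqOn {N : Type*} [Finite N] {σ τ : Equiv.Perm N} {S : Set N}
    (hτ : Set.MapsTo τ S S) (h : Set.EqOn τ σ S) {i : N} (hi : i ∈ S) :
    outcome τ i = outcome σ i := by
  have hmem : τ.symm i ∈ S := Equiv.Perm.perm_symm_mapsTo_of_mapsTo τ hτ hi
  refine Prod.ext (h hi) ?_
  change τ.symm i = σ.symm i
  rw [Equiv.eq_symm_apply, ← h hmem, Equiv.apply_symm_apply]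

/-- every temporary exchange instance in which all agents have
house-predominant preferences admits a core stable and Pareto optimal allocation. -/
theorem house_predominant_core_and_PO {N : Type*} [Fintype N]
    (hs ns : N → N → N → Prop)
    (hhs : ∀ i, IsStrictTotalOrder N (hs i))
    (hns : ∀ i, IsStrictTotalOrder N (ns i)) :
    ∃ σ : Equiv.Perm N,
      CoreStable (fun i => housePredPref (hs i) (ns i)) σ ∧
      ParetoOptimal (fun i => housePredPref (hs i) (ns i)) σ := by
  obtain ⟨σ, -, hσ⟩ := exists_perm_strict_core_on hs (fun i => have := hhs i; inferInstance)
    (Finset.univ : Finset N)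
  have key : ∀ (τ : Equiv.Perm N) (S : Set N), Set.MapsTo τ S S →
      (∀ i ∈ S, housePredPref (hs i) (ns i) (outcome τ i) (outcome σ i)) →
      ∀ i ∈ S, outcome τ i = outcome σ i := fun τ S hτ hpref i hi =>
    outcome_eq_of_eqOn hτ
      (hσ τ S (by simp) hτ fun j hj => (hpref j hj).imp_right And.left) hi
  refine ⟨σ, ?_, ?_⟩
  · rintro S ⟨⟨i, hi⟩, τ, hfix, hpref⟩
    have hτ : Set.MapsTo τ S S := fun j hj => by
      by_contra h
      exact h ((τ.injective (hfix _ h)).symm ▸ hj)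
    have heq := key τ S hτ (fun j hj => (hpref j hj).1) i hi
    have hi' := hpref i hi
    rw [heq] at hi'
    exact hi'.2 hi'.1
  · rintro ⟨τ, hpref, i, hi⟩
    rw [key τ Set.univ (Set.mapsTo_univ _ _) (fun j _ => hpref j) i (Set.mem_univ i)] at hi
    exact hi.2 hi.1
end

section
/- For temporary exchange instances with a fixed finite agent set N in which all agents have house-predominant preferences, there exists a strategyproof mechanism that always returns a core stable and Pareto optimal allocation. That is, there is a function f mapping each house-predominant preference profile to an allocation, such that f(≿) is core stable and Pareto optimal for every profile, and no agent i can obtain a strictly preferred outcome (with respect to her true house-predominant preference) by reporting a different house-predominant preference. -/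
open scoped Classical

/-- `σ` results from trading along top trading cycles in rounds, `r i` being the round in which
`i` leaves: cycles stay within a round, and any house which `i` prefers to the one she gets
has left in an earlier round. Here `P i a b` says that `i` prefers the house of `a` to that
of `b`. -/
structure IsTopTrading {N : Type*} (P : N → N → N → Prop) (σ : Equiv.Perm N) (r : N → ℕ) :
    Prop where
  rank_apply : ∀ i, r (σ i) = r i
  rank_lt : ∀ i j, P i j (σ i) → r j < r i

theorem Equiv.Perm.apply_eq_of_apply_le {N : Type*} (σ : Equiv.Perm N) (s : Finset N)
    (hs : ∀ i, i ∈ s ↔ σ i ∈ s) (r : N → ℕ) (h : ∀ i ∈ s, r (σ i) ≤ r i) :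
    ∀ i ∈ s, r (σ i) = r i :=
  (Finset.sum_eq_sum_iff_of_le h).1 (Finset.sum_equiv σ hs fun _ _ => rfl)

theorem exists_mem_forall_not_rel {N : Type*} [Finite N] (R : N → N → Prop)
    [IsStrictTotalOrder N R] (A : Set N) (hA : A.Nonempty) :
    ∃ t ∈ A, ∀ j ∈ A, ¬ R j t :=
  (Finite.wellFounded_of_trans_of_irrefl R).has_min A hA

theorem Function.periodicPts_nonempty {N : Type*} [Finite N] [Nonempty N] (t : N → N) :
    (Function.periodicPts t).Nonempty := by
  obtain ⟨x⟩ := ‹Nonempty N›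
  obtain ⟨m, n, hmn, h⟩ := Finite.exists_ne_map_eq_of_infinite fun n : ℕ => t^[n] x
  wlog hlt : m < n generalizing m n
  · exact this n m hmn.symm h.symm (by omega)
  refine ⟨t^[m] x, Function.mk_mem_periodicPts (n := n - m) (by omega) ?_⟩
  simp only [Function.IsPeriodicPt, Function.IsFixedPt, ← Function.iterate_add_apply]
  rw [Nat.sub_add_cancel hlt.le]
  exact h.symm

theorem exists_topTrading_on {N : Type*} [Finite N] (P : N → N → N → Prop)
    (hP : ∀ i, IsStrictTotalOrder N (P i)) (A : Set N) :
    ∃ (g : N → N) (r : N → ℕ), Set.MapsTo g A A ∧ Set.InjOn g A ∧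
      (∀ i ∈ A, r (g i) = r i) ∧ ∀ i ∈ A, ∀ j ∈ A, P i j (g i) → r j < r i := by
  induction A using WellFoundedLT.induction with
  | ind A ih =>
  rcases A.eq_empty_or_nonempty with rfl | hA
  · exact ⟨id, 0, by simp⟩
  choose t ht hmax using fun i => have := hP i; exists_mem_forall_not_rel (P i) A hA
  set C := Function.periodicPts t
  have : Nonempty N := hA.to_type
  obtain ⟨c, hc⟩ := Function.periodicPts_nonempty t
  have htC : Set.BijOn t C C := Function.bijOn_periodicPts t
  have hCA : C ⊆ A := fun x hx => by
    obtain ⟨y, -, rfl⟩ := htC.surjOn hx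
    exact ht y
  have hlt : A \ C < A :=
    ⟨Set.sdiff_subset, fun h => (h (hCA hc)).2 hc⟩
  obtain ⟨g, r, hmaps, hinj, hr, hrank⟩ := ih _ hlt
  have hmaps' : ∀ i ∈ A, i ∉ C → g i ∈ A ∧ g i ∉ C := fun i hi hiC => hmaps ⟨hi, hiC⟩
  refine ⟨fun i => if i ∈ C then t i else g i, fun i => if i ∈ C then 0 else r i + 1,
    fun i hi => ?_, fun i hi j hj hij => ?_, fun i hi => ?_, fun i hi j hj hij => ?_⟩
  · by_cases hiC : i ∈ C
    · simpa [hiC] using ht i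
    · simpa [hiC] using (hmaps' i hi hiC).1
  · by_cases hiC : i ∈ C <;> by_cases hjC : j ∈ C <;> simp only [hiC, hjC, if_true, if_false] at hij
    · exact htC.injOn hiC hjC hij
    · exact absurd (hij ▸ htC.mapsTo hiC) (hmaps' j hj hjC).2
    · exact absurd (hij ▸ htC.mapsTo hjC) (hmaps' i hi hiC).2
    · exact hinj ⟨hi, hiC⟩ ⟨hj, hjC⟩ hij
  · by_cases hiC : i ∈ C
    · simp [hiC, htC.mapsTo hiC]
    · simp [hiC, (hmaps' i hi hiC).2, hr i ⟨hi, hiC⟩]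
  · by_cases hiC : i ∈ C
    · simp only [hiC, if_true] at hij
      exact absurd hij (hmax i j hj)
    · by_cases hjC : j ∈ C
      · simp [hiC, hjC]
      · simp only [hiC, if_false] at hij
        simpa [hiC, hjC] using hrank i ⟨hi, hiC⟩ j ⟨hj, hjC⟩ hij

theorem exists_isTopTrading {N : Type*} [Finite N] (P : N → N → N → Prop)
    (hP : ∀ i, IsStrictTotalOrder N (P i)) :
    ∃ (σ : Equiv.Perm N) (r : N → ℕ), IsTopTrading P σ r := by
  obtain ⟨g, r, -, hinj, hr, hlt⟩ := exists_topTrading_on P hP Set.univ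
  refine ⟨Equiv.ofBijective g (Finite.injective_iff_bijective.1 (Set.injOn_univ.1 hinj)), r, ?_, ?_⟩
  · exact fun i => hr i trivial
  · exact fun i j => hlt i trivial j trivial

namespace IsTopTrading

variable {N : Type*} {P P' : N → N → N → Prop} {σ σ' τ : Equiv.Perm N} {r r' : N → ℕ}

/-- Top trading allocations lie in the strict core: a reallocation within `S` giving no member
a worse house gives all members the same houses. -/
theorem apply_eq_of_weakly_better [Finite N] (h : IsTopTrading P σ r) {S : Set N}
    (hτ : ∀ i ∉ S, τ i = i) (hb : ∀ i ∈ S, P i (τ i) (σ i) ∨ τ i = σ i) :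
    ∀ i ∈ S, τ i = σ i := by
  have := Fintype.ofFinite N
  have hle : ∀ i ∈ Finset.univ, r (τ i) ≤ r i := fun i _ => by
    by_cases hi : i ∈ S
    · rcases hb i hi with hi | hi
      · exact (h.rank_lt _ _ hi).le
      · exact (hi ▸ h.rank_apply i).le
    · rw [hτ i hi]
  have heq := τ.apply_eq_of_apply_le Finset.univ (by simp) r hle
  exact fun i hi => (hb i hi).resolve_left fun hlt =>
    (h.rank_lt _ _ hlt).ne (heq i (Finset.mem_univ i))

theorem le_rank_apply (h : IsTopTrading P σ r) {n : ℕ} (hlow : ∀ j, r j < n → σ' j = σ j)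
    {j : N} (hj : n ≤ r j) : n ≤ r (σ' j) := by
  by_contra! hlt
  have hl : r (σ.symm (σ' j)) < n := by
    rwa [← h.rank_apply, Equiv.apply_symm_apply]
  have := hlow _ hl
  rw [Equiv.apply_symm_apply, EmbeddingLike.apply_eq_iff_eq] at this
  rw [this] at hl
  omega

/-- If two top trading allocations agree on the agents leaving before round `n` of the first,
they agree on those leaving in round `n`, as long as they agree on those of them whose
preferences differ. -/
theorem apply_eq_of_rank_eq [Finite N] (h : IsTopTrading P σ r) (h' : IsTopTrading P' σ' r')
    (hP : ∀ i, IsStrictTotalOrder N (P i)) {n : ℕ} (hlow : ∀ j, r j < n → σ' j = σ j)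
    (hn : ∀ j, r j = n → P' j = P j ∨ σ' j = σ j) :
    ∀ j, r j = n → σ' j = σ j := by
  have := Fintype.ofFinite N
  have hcases : ∀ j, r j = n → P' j (σ j) (σ' j) ∨ σ' j = σ j := fun j hj => by
    rcases hn j hj with hPj | hσ
    · have hge := h.le_rank_apply hlow hj.ge
      have hnot : ¬ P j (σ' j) (σ j) := fun hlt => by
        have := h.rank_lt _ _ hlt
        omega
      have := hP j
      rcases trichotomous_of (P j) (σ j) (σ' j) with h1 | h1 | h1
      · exact .inl (hPj ▸ h1)
      · exact .inr h1.symm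
      · exact absurd h1 hnot
    · exact .inr hσ
  have heq := σ.apply_eq_of_apply_le {j | r j = n} (by simp [h.rank_apply]) r' fun j hj => by
    rcases hcases j (by simpa using hj) with hlt | hσ
    · exact (h'.rank_lt _ _ hlt).le
    · exact (hσ ▸ h'.rank_apply j).le
  exact fun j hj => (hcases j hj).resolve_left fun hlt =>
    (h'.rank_lt _ _ hlt).ne (heq j (by simpa using hj))

theorem apply_eq_of_rank_lt [Finite N] (h : IsTopTrading P σ r) (h' : IsTopTrading P' σ' r')
    (hP : ∀ i, IsStrictTotalOrder N (P i)) {i : N} (hPP' : ∀ j ≠ i, P' j = P j) :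
    ∀ n ≤ r i, ∀ j, r j < n → σ' j = σ j := by
  intro n hn
  induction n with
  | zero => intro j hj; omega
  | succ n ih =>
    intro j hj
    rcases (Nat.lt_succ_iff.1 hj).lt_or_eq with hj | hj
    · exact ih (by omega) j hj
    · refine h.apply_eq_of_rank_eq h' hP (ih (by omega)) (fun k hk => .inl (hPP' k ?_)) j hj
      rintro rfl
      omega

/-- No agent gets a better house by misreporting. -/
theorem not_rel_apply [Finite N] (h : IsTopTrading P σ r) (h' : IsTopTrading P' σ' r')
    (hP : ∀ i, IsStrictTotalOrder N (P i)) {i : N} (hPP' : ∀ j ≠ i, P' j = P j) :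
    ¬ P i (σ' i) (σ i) := fun hlt =>
  (h.rank_lt _ _ hlt).not_ge
    (h.le_rank_apply (h.apply_eq_of_rank_lt h' hP hPP' _ le_rfl) le_rfl)

/-- An agent who gets the same house after misreporting also gets the same tenant. -/
theorem symm_apply_eq [Finite N] (h : IsTopTrading P σ r) (h' : IsTopTrading P' σ' r')
    (hP : ∀ i, IsStrictTotalOrder N (P i)) {i : N} (hPP' : ∀ j ≠ i, P' j = P j)
    (hi : σ' i = σ i) : σ'.symm i = σ.symm i := by
  have hlow := h.apply_eq_of_rank_lt h' hP hPP' _ le_rfl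
  have heq := h.apply_eq_of_rank_eq h' hP hlow (fun j _ => by
    by_cases hj : j = i
    · exact .inr (hj ▸ hi)
    · exact .inl (hPP' j hj)) (σ.symm i) (by rw [← h.rank_apply, Equiv.apply_symm_apply])
  rw [Equiv.symm_apply_eq, heq, Equiv.apply_symm_apply]

end IsTopTrading

/-- for a fixed finite agent set with house-predominant preferences,
there is a strategyproof mechanism that always returns a core stable and Pareto
optimal allocation. A profile assigns to each agent a pair of strict total orders
(over house-owners and over tenants); the induced preference is lexicographic with
houses first. -/
theorem house_predominant_SP_mechanism {N : Type*} [Fintype N] [DecidableEq N] :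
    ∃ f : (N → (N → N → Prop) × (N → N → Prop)) → Equiv.Perm N,
      (∀ p : N → (N → N → Prop) × (N → N → Prop),
        (∀ i, IsStrictTotalOrder N (p i).1 ∧ IsStrictTotalOrder N (p i).2) →
          CoreStable (fun i => housePredPref (p i).1 (p i).2) (f p) ∧
          ParetoOptimal (fun i => housePredPref (p i).1 (p i).2) (f p)) ∧
      (∀ p : N → (N → N → Prop) × (N → N → Prop),
        (∀ i, IsStrictTotalOrder N (p i).1 ∧ IsStrictTotalOrder N (p i).2) →
        ∀ (i : N) (q : (N → N → Prop) × (N → N → Prop)),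
          IsStrictTotalOrder N q.1 → IsStrictTotalOrder N q.2 →
          ¬ SPref (housePredPref (p i).1 (p i).2)
              (outcome (f (Function.update p i q)) i) (outcome (f p) i)) := by
  have hex : ∀ p : N → (N → N → Prop) × (N → N → Prop), ∃ σ : Equiv.Perm N,
      (∀ i, IsStrictTotalOrder N (p i).1) → ∃ r, IsTopTrading (fun i => (p i).1) σ r := fun p => by
    by_cases hp : ∀ i, IsStrictTotalOrder N (p i).1
    · obtain ⟨σ, r, h⟩ := exists_isTopTrading (fun i => (p i).1) hp
      exact ⟨σ, fun _ => ⟨r, h⟩⟩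
    · exact ⟨1, fun h => absurd h hp⟩
  choose f hf using hex
  refine ⟨f, fun p hp => ?_, fun p hp i q hq _ hbetter => ?_⟩
  · obtain ⟨r, h⟩ := hf p fun i => (hp i).1
    constructor
    · rintro S ⟨⟨i, hi⟩, τ, hτ, hb⟩
      have heq := h.apply_eq_of_weakly_better hτ fun j hj => (hb j hj).1.imp_right And.left
      have hmem : τ.symm i ∈ S := by
        by_contra hmem
        have := hτ _ hmem
        rw [Equiv.apply_symm_apply] at this
        exact hmem (this ▸ hi)
      have hsymm : τ.symm i = (f p).symm i := by
        rw [Equiv.eq_symm_apply, ← heq _ hmem, Equiv.apply_symm_apply]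
      have hout : outcome τ i = outcome (f p) i := Prod.ext (heq i hi) hsymm
      have hi' := hb i hi
      rw [hout] at hi'
      exact hi'.2 hi'.1
    · rintro ⟨τ, hb, j, hj⟩
      have heq := h.apply_eq_of_weakly_better (S := Set.univ) (τ := τ) (by simp)
        fun i _ => (hb i).imp_right And.left
      obtain rfl : τ = f p := Equiv.ext fun i => heq i trivial
      exact hj.2 hj.1
  · obtain ⟨r, h⟩ := hf p fun i => (hp i).1
    obtain ⟨r', h'⟩ := hf (Function.update p i q) fun j => by
      by_cases hj : j = i
      · subst hj; simpa using hq
      · simpa [hj] using (hp j).1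
    have hPP' : ∀ j ≠ i, (Function.update p i q j).1 = (p j).1 := fun j hj => by simp [hj]
    rcases hbetter.1 with hlt | ⟨hi, -⟩
    · exact h.not_rel_apply h' (fun i => (hp i).1) hPP' hlt
    · have hsymm := h.symm_apply_eq h' (fun i => (hp i).1) hPP' hi
      have heq : outcome (f (Function.update p i q)) i = outcome (f p) i := Prod.ext hi hsymm
      rw [heq] at hbetter
      exact hbetter.2 hbetter.1
end

section
/- Every temporary exchange instance in which all agents have tenant-predominant preferences admits an allocation that is both core stable and Pareto optimal. -/
open scoped Classical

/-- The tenant-predominant (weak) preference over outcomes induced by a strict order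
`ns` over tenants and a strict order `hs` over house-owners: lexicographic with
tenants first. -/
def tenantPredPref {N : Type*} (ns hs : N → N → Prop) (a b : N × N) : Prop :=
  ns a.2 b.2 ∨ (a.2 = b.2 ∧ (hs a.1 b.1 ∨ a.1 = b.1))

/-- A self-map of a nonempty finite type has a periodic point. -/
theorem exists_mem_periodicPts {N : Type*} [Finite N] [Nonempty N] (f : N → N) :
    ∃ x, x ∈ Function.periodicPts f := by
  obtain ⟨x⟩ := ‹Nonempty N›
  obtain ⟨m, n, hmn, h⟩ := Finite.exists_ne_map_eq_of_infinite (fun n : ℕ => f^[n] x)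
  wlog hlt : m < n generalizing m n
  · exact this n m hmn.symm h.symm (by omega)
  refine ⟨f^[m] x, Function.mk_mem_periodicPts (n := n - m) (by omega) ?_⟩
  change f^[n - m] (f^[m] x) = f^[m] x
  rw [← Function.iterate_add_apply, Nat.sub_add_cancel hlt.le]
  exact h.symm

/-- Gale's top trading cycles: with strict preferences `r`, every set `A` of agents has a
permutation in the strict core of the exchange market restricted to `A`. -/
theorem exists_strictCore {N : Type*} [Finite N] (r : N → N → N → Prop)
    (hr : ∀ i, IsStrictTotalOrder N (r i)) (A : Set N) :
    ∃ π : Equiv.Perm N, (∀ i ∉ A, π i = i) ∧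
      ∀ (S : Set N) (τ : Equiv.Perm N), S ⊆ A → Set.MapsTo τ S S →
        (∀ i ∈ S, r i (τ i) (π i) ∨ τ i = π i) → ∀ i ∈ S, τ i = π i := by
  induction A using WellFoundedLT.induction with
  | ind A ih =>
  rcases A.eq_empty_or_nonempty with rfl | hA
  · exact ⟨1, fun _ _ => rfl, fun S τ hS _ _ i hi => (hS hi).elim⟩
  have hbest : ∀ i, ∃ m ∈ A, ∀ x ∈ A, ¬ r i x m := fun i => by
    have := hr i
    exact (Finite.wellFounded_of_trans_of_irrefl (r i)).has_min A hA
  choose f hfA hf using hbest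
  have : Nonempty N := hA.to_type
  set C := Function.periodicPts f with hC
  have hbij : Set.BijOn f C C := Function.bijOn_periodicPts f
  have hCA : C ⊆ A := fun x hx => by
    obtain ⟨y, -, rfl⟩ := hbij.surjOn hx
    exact hfA y
  obtain ⟨c, hc⟩ := exists_mem_periodicPts f
  obtain ⟨π, hπ, hcore⟩ := ih (A \ C)
    (Set.ssubset_iff_subset_ne.2 ⟨Set.sdiff_subset, fun h => (h.ge (hCA hc)).2 hc⟩)
  have hπC : ∀ i ∉ C, π i ∉ C := fun i hi h =>
    hi (π.injective (hπ (π i) fun h' => h'.2 h) ▸ h)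
  have hinj : Function.Injective fun i => if i ∈ C then f i else π i := by
    intro i j hij
    by_cases hi : i ∈ C <;> by_cases hj : j ∈ C <;> simp only [hi, hj, if_true, if_false] at hij
    · exact hbij.injOn hi hj hij
    · exact (hπC j hj (hij ▸ hbij.mapsTo hi)).elim
    · exact (hπC i hi (hij ▸ hbij.mapsTo hj)).elim
    · exact π.injective hij
  refine ⟨Equiv.ofBijective _ (Finite.injective_iff_bijective.1 hinj), fun i hi => ?_,
    fun S τ hSA hτS hpref => ?_⟩
  · have hiC : i ∉ C := fun h => hi (hCA h)
    simpa [hiC] using hπ i fun h => hi h.1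
  simp only [Equiv.ofBijective_apply] at hpref ⊢
  have hτf : ∀ i ∈ S ∩ C, τ i = f i := fun i hi => by
    have := hpref i hi.1
    rw [if_pos hi.2] at this
    exact this.resolve_left (hf i _ (hSA (hτS hi.1)))
  have hτC : Set.MapsTo τ (S ∩ C) (S ∩ C) := fun i hi =>
    ⟨hτS hi.1, hτf i hi ▸ hbij.mapsTo hi.2⟩
  have hτD : Set.MapsTo τ (S \ C) (S \ C) := fun i hi => by
    refine ⟨hτS hi.1, fun h => hi.2 ?_⟩
    simpa using (Equiv.Perm.perm_symm_mapsTo_of_mapsTo τ hτC ⟨hτS hi.1, h⟩).2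
  intro i hi
  by_cases hiC : i ∈ C
  · rw [if_pos hiC]
    exact hτf i ⟨hi, hiC⟩
  · rw [if_neg hiC]
    refine hcore (S \ C) τ (Set.sdiff_subset_sdiff_left hSA) hτD (fun j hj => ?_) i ⟨hi, hiC⟩
    simpa only [if_neg hj.2] using hpref j hj.1

/-- every temporary exchange instance in which all agents have
tenant-predominant preferences admits a core stable and Pareto optimal allocation. -/
theorem tenant_predominant_core_and_PO {N : Type*} [Fintype N]
    (ns hs : N → N → N → Prop)
    (hns : ∀ i, IsStrictTotalOrder N (ns i))
    (hhs : ∀ i, IsStrictTotalOrder N (hs i)) :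
    ∃ σ : Equiv.Perm N,
      CoreStable (fun i => tenantPredPref (ns i) (hs i)) σ ∧
      ParetoOptimal (fun i => tenantPredPref (ns i) (hs i)) σ := by
  obtain ⟨π, -, hπ⟩ := exists_strictCore ns hns Set.univ
  have key : ∀ (S : Set N) (τ : Equiv.Perm N), Set.MapsTo τ S S →
      (∀ i ∈ S, tenantPredPref (ns i) (hs i) (outcome τ i) (outcome π.symm i)) →
      ∀ i ∈ S, outcome τ i = outcome π.symm i := by
    intro S τ hτ hpref
    have hτ' : Set.MapsTo τ.symm S S := Equiv.Perm.perm_symm_mapsTo_of_mapsTo τ hτ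
    have hsymm := hπ S τ.symm (Set.subset_univ S) hτ' fun i hi =>
      (hpref i hi).imp id fun h => h.1
    refine fun i hi => Prod.ext ?_ (hsymm i hi)
    have h := hsymm (τ i) (hτ hi)
    rw [Equiv.symm_apply_apply] at h
    exact (π.symm_apply_eq.2 h).symm
  refine ⟨π.symm, ?_, ?_⟩
  · rintro S ⟨⟨i, hi⟩, τ, hfix, hτ⟩
    have hmaps : Set.MapsTo τ S S := fun j hj => by
      by_contra h
      rw [τ.injective (hfix _ h)] at h
      exact h hj
    have h := hτ i hi
    rw [key S τ hmaps (fun j hj => (hτ j hj).1) i hi] at h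
    exact h.2 h.1
  · rintro ⟨τ, hτ, j, hj⟩
    rw [key Set.univ τ (Set.mapsTo_univ _ _) (fun i _ => hτ i) j trivial] at hj
    exact hj.2 hj.1
end

section
/- In the responsive temporary exchange setting, if every agent's underlying preference ≿_i^H over house-owners is a strict linear order (while her preference ≿_i^N over tenants is an arbitrary total preorder), then an RS core stable allocation exists. -/
open scoped Classical

/-- `r` is a total preorder: total and transitive. -/
def TotalPreorderRel {α : Type*} (r : α → α → Prop) : Prop :=
  (∀ a b, r a b ∨ r b a) ∧ (∀ a b c, r a b → r b c → r a c)

/-- Strict preference in the responsive set extension determined by a weak preference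
`hw` over house-owners and a weak preference `nw` over tenants: `(h, j)` is strictly
RS-preferred to `(h', j')` if `h ≿ᴴ h'` and `j ≿ᴺ j'`, with at least one of the two
comparisons strict. -/
def RSstrict {N : Type*} (hw nw : N → N → Prop) (a b : N × N) : Prop :=
  hw a.1 b.1 ∧ nw a.2 b.2 ∧
    ((hw a.1 b.1 ∧ ¬ hw b.1 a.1) ∨ (nw a.2 b.2 ∧ ¬ nw b.2 a.2))

/-- A nonempty coalition `S` RS-blocks allocation `σ`: there is a permutation `τ` of `S`
(fixing all agents outside `S`) under which every member of `S` is strictly RS-better off. -/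
def RSBlocks {N : Type*} (hw nw : N → N → N → Prop)
    (σ : Equiv.Perm N) (S : Set N) : Prop :=
  S.Nonempty ∧ ∃ τ : Equiv.Perm N, (∀ i ∉ S, τ i = i) ∧
    ∀ i ∈ S, RSstrict (hw i) (nw i) (outcome τ i) (outcome σ i)

/-- An allocation is RS core stable if no coalition RS-blocks it. -/
def RSCoreStable {N : Type*} (hw nw : N → N → N → Prop) (σ : Equiv.Perm N) : Prop :=
  ∀ S : Set N, ¬ RSBlocks hw nw σ S

/-- A self-map of a nonempty finite set restricts to an injective self-map of some nonempty
subset. -/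
theorem exists_subset_mapsTo_injOn {N : Type*} (f : N → N) (A : Finset N)
    (hA : A.Nonempty) (hf : Set.MapsTo f A A) :
    ∃ C ⊆ A, C.Nonempty ∧ Set.MapsTo f C C ∧ Set.InjOn f C := by
  obtain ⟨C, hCA, ⟨hne, hmaps⟩, hmin⟩ := exists_minimal_le_of_wellFoundedLT
    (fun C : Finset N => C.Nonempty ∧ Set.MapsTo f C C) A ⟨hA, hf⟩
  have himage : C.image f ⊆ C := Finset.image_subset_iff.2 fun _ hx => hmaps hx
  have hsub : C ⊆ C.image f :=
    hmin ⟨hne.image f, fun _ hx => Finset.mem_coe.2 (Finset.mem_image_of_mem f (himage hx))⟩ himage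
  refine ⟨C, hCA, hne, hmaps, Finset.card_image_iff.1 ?_⟩
  rw [himage.antisymm hsub]

/-- For strict house preferences there is an allocation of the houses of `A` within `A` (top
trading cycles) that agrees on every coalition `S ⊆ A` with each reallocation within `S` that
is weakly better for all members of `S`. -/
theorem exists_allocation_eq_of_weakly_better {N : Type*} [Finite N]
    (hs : N → N → N → Prop) (hhs : ∀ i, IsStrictTotalOrder N (hs i)) (A : Finset N) :
    ∃ σ : N → N, Set.MapsTo σ A A ∧ Set.InjOn σ A ∧
      ∀ S ⊆ A, ∀ τ : N → N, Set.MapsTo τ S S → Set.InjOn τ S →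
        (∀ i ∈ S, hs i (τ i) (σ i) ∨ τ i = σ i) → ∀ i ∈ S, τ i = σ i := by
  induction A using Finset.strongInduction with
  | H A ih =>
    rcases A.eq_empty_or_nonempty with rfl | hA
    · exact ⟨id, by simp, by simp, fun S hS _ _ _ _ i hi => absurd (hS hi) (by simp)⟩
    have htop : ∀ i, ∃ m ∈ A, ∀ x ∈ A, ¬ hs i x m := fun i =>
      have := hhs i
      (Finite.wellFounded_of_trans_of_irrefl (hs i)).has_min (A : Set N) hA
    choose f hfA hftop using htop
    obtain ⟨C, hCA, hCne, hfC, hfinj⟩ :=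
      exists_subset_mapsTo_injOn f A hA fun i _ => hfA i
    obtain ⟨σ, hσmaps, hσinj, hσ⟩ := ih (A \ C) (Finset.sdiff_ssubset hCA hCne)
    have hσ_mem : ∀ i ∈ A, i ∉ C → σ i ∈ A ∧ σ i ∉ C := fun i hi hiC =>
      Finset.mem_sdiff.1 (hσmaps (Finset.mem_sdiff.2 ⟨hi, hiC⟩))
    refine ⟨fun i => if i ∈ C then f i else σ i, ?_, ?_, ?_⟩
    · intro i hi
      by_cases hiC : i ∈ C
      · simpa [hiC] using hfA i
      · simpa [hiC] using (hσ_mem i hi hiC).1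
    · intro i hi j hj hij
      by_cases hiC : i ∈ C <;> by_cases hjC : j ∈ C <;> simp only [hiC, hjC, if_true, if_false] at hij
      · exact hfinj hiC hjC hij
      · exact absurd (hij ▸ hfC hiC) (hσ_mem j hj hjC).2
      · exact absurd (hij ▸ hfC hjC) (hσ_mem i hi hiC).2
      · exact hσinj (Finset.mem_sdiff.2 ⟨hi, hiC⟩) (Finset.mem_sdiff.2 ⟨hj, hjC⟩) hij
    · intro S hSA τ hτ hτinj hbetter
      have hτf : ∀ i ∈ S, i ∈ C → τ i = f i := by
        intro i hi hiC
        have h := hbetter i hi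
        simp only [hiC, if_true] at h
        exact h.resolve_left (hftop i _ (hSA (hτ hi)))
      have hτSC : Set.MapsTo τ (S ∩ C : Finset N) (S ∩ C : Finset N) := by
        intro i hi
        obtain ⟨hiS, hiC⟩ := Finset.mem_inter.1 hi
        exact Finset.mem_inter.2 ⟨hτ hiS, hτf i hiS hiC ▸ hfC hiC⟩
      have hsurj := Finset.surjOn_of_injOn_of_card_le τ hτSC
        (hτinj.mono (Finset.coe_subset.2 Finset.inter_subset_left)) le_rfl
      have hτdiff : Set.MapsTo τ (S \ C : Finset N) (S \ C : Finset N) := by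
        intro i hi
        obtain ⟨hiS, hiC⟩ := Finset.mem_sdiff.1 hi
        refine Finset.mem_sdiff.2 ⟨hτ hiS, fun hmem => hiC ?_⟩
        obtain ⟨j, hj, hji⟩ := hsurj (Finset.mem_coe.2 (Finset.mem_inter.2 ⟨hτ hiS, hmem⟩))
        obtain ⟨hjS, hjC⟩ := Finset.mem_inter.1 hj
        exact hτinj hjS hiS hji ▸ hjC
      have hrest := hσ (S \ C) (Finset.sdiff_subset_sdiff hSA subset_rfl) τ hτdiff
        (hτinj.mono (Finset.coe_subset.2 Finset.sdiff_subset)) fun i hi => by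
          obtain ⟨hiS, hiC⟩ := Finset.mem_sdiff.1 hi
          simpa only [hiC, if_false] using hbetter i hiS
      intro i hi
      by_cases hiC : i ∈ C
      · simpa only [hiC, if_true] using hτf i hi hiC
      · simpa only [hiC, if_false] using hrest i (Finset.mem_sdiff.2 ⟨hi, hiC⟩)

/-- Strict preference in the responsive set extension is irreflexive. -/
theorem not_RSstrict_self {N : Type*} (hw nw : N → N → Prop) (a : N × N) :
    ¬ RSstrict hw nw a a := by
  rintro ⟨-, -, ⟨h, h'⟩ | ⟨h, h'⟩⟩ <;> exact h' h

/-- in the responsive setting, if every agent's preference over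
house-owners is a strict linear order (its weak version being `hs i a b ∨ a = b`)
while her preference over tenants is an arbitrary total preorder, then an RS core
stable allocation exists. -/
theorem RS_core_exists_of_strict_house_prefs {N : Type*} [Fintype N]
    (hs : N → N → N → Prop) (nw : N → N → N → Prop)
    (hhs : ∀ i, IsStrictTotalOrder N (hs i))
    (hnw : ∀ i, TotalPreorderRel (nw i)) :
    ∃ σ : Equiv.Perm N, RSCoreStable (fun i a b => hs i a b ∨ a = b) nw σ := by
  obtain ⟨σ, -, hσinj, hσ⟩ := exists_allocation_eq_of_weakly_better hs hhs Finset.univ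
  have hinj : Function.Injective σ := fun i j h => hσinj (by simp) (by simp) h
  refine ⟨Equiv.ofBijective σ (Finite.injective_iff_bijective.1 hinj), ?_⟩
  rintro S ⟨⟨i, hi⟩, τ, hτ, hblock⟩
  have hmaps : ∀ j ∈ S, τ j ∈ S := fun j hj => by
    by_contra hn
    exact hn (by rwa [τ.injective (hτ _ hn)])
  have heq : ∀ j ∈ S, τ j = σ j := fun j hj =>
    hσ S.toFinset (Finset.subset_univ _) τ (fun k hk => by simpa using hmaps k (by simpa using hk))
      τ.injective.injOn (fun k hk => (hblock k (by simpa using hk)).1) j (by simpa using hj)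
  have hpre : τ.symm i ∈ S := by
    by_contra hn
    have h := hτ _ hn
    rw [τ.apply_symm_apply] at h
    exact hn (h ▸ hi)
  have hout : outcome τ i = outcome (Equiv.ofBijective σ (Finite.injective_iff_bijective.1 hinj)) i := by
    refine Prod.ext (heq i hi) ?_
    rw [outcome, outcome, Equiv.eq_symm_apply, Equiv.ofBijective_apply, ← heq _ hpre,
      τ.apply_symm_apply]
  exact not_RSstrict_self _ _ _ (hout ▸ hblock i hi)
end
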